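/- arXiv:1405.3391 — 2 statements merged into one kernel-verified Lean document; each statement's English description precedes it below -/
import Mathlib

section
/- Let V be a real inner product space (Euclidean space) regarded as a metric space with points A, B, C, D. If B lies weakly between A and C (i.e., B is on the segment from A to C), dist A B = dist A D, and dist C B = dist C D, then B = D. (Theorem 4.19 of Schwabhäuser–Szmielew–Tarski, the worked example of the paper, interpreted with betweenness as segment membership and congruence of point pairs as equality of distances.) -/
theorem tarski_th_4_19 {V : Type*} [NormedAddCommGroup V] [InnerProductSpace ℝ V]
    (A B C D : V) (hbet : Wbtw ℝ A B C)
    (h1 : dist A B = dist A D) (h2 : dist C B = dist C D) : B = D := by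
  obtain ⟨t, ⟨ht0, ht1⟩, rfl⟩ := hbet
  refine (eq_lineMap_of_dist_eq_mul_of_dist_eq_mul ?_ ?_).symm
  · rw [← h1, dist_left_lineMap, Real.norm_of_nonneg ht0]
  · rw [dist_comm D C, ← h2, dist_right_lineMap, Real.norm_of_nonneg (sub_nonneg.2 ht1)]
end

section
/- Let V be a real inner product space (Euclidean space) with points A, B, C, D. If C ≠ A, the point B is collinear with C and A (i.e., the set {C, A, B} is collinear over ℝ), dist C B = dist C D, and dist A B = dist A D, then B = D. (Theorem 4.18 of Schwabhäuser–Szmielew–Tarski, used as the key auxiliary lemma in the paper's proof of Theorem 4.19: a point on a line is uniquely determined by its distances to two distinct points of that line.) -/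
theorem tarski_th_4_18 {V : Type*} [NormedAddCommGroup V] [InnerProductSpace ℝ V]
    (A B C D : V) (hCA : C ≠ A) (hcol : Collinear ℝ ({C, A, B} : Set V))
    (h1 : dist C B = dist C D) (h2 : dist A B = dist A D) : B = D := by
  have hB : B ∈ line[ℝ, C, A] :=
    hcol.mem_affineSpan_of_mem_of_ne (by simp) (by simp) (by simp) hCA
  obtain ⟨t, rfl⟩ := mem_affineSpan_pair_iff_exists_lineMap_eq.1 hB
  obtain ⟨u, rfl⟩ : ∃ u, A = C + u := ⟨A - C, by abel⟩
  obtain ⟨d, rfl⟩ : ∃ d, D = C + d := ⟨D - C, by abel⟩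
  have hline : AffineMap.lineMap C (C + u) t = C + t • u := by
    simp [AffineMap.lineMap_apply, add_comm]
  rw [hline] at h1 h2 ⊢
  simp only [dist_eq_norm, add_sub_add_left_eq_sub, sub_add_cancel_left, norm_neg] at h1 h2
  have e1 := congrArg (· ^ 2) h1
  have e2 := congrArg (· ^ 2) h2
  simp only [norm_sub_sq_real, inner_smul_right] at e1 e2
  rw [real_inner_self_eq_norm_sq] at e2
  have hnorm : ‖t • u - d‖ ^ 2 = 0 := by
    rw [norm_sub_sq_real, real_inner_smul_left]
    have e3 : ‖t • u‖ ^ 2 = t ^ 2 * ‖u‖ ^ 2 := by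
      rw [norm_smul, mul_pow, Real.norm_eq_abs, sq_abs]
    linear_combination (t - 1) * e1 - t * e2 + 2 * e3
  rw [sub_eq_zero.1 (norm_eq_zero.1 (pow_eq_zero_iff two_ne_zero |>.1 hnorm))]
end
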